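/- Let n = 2, let ξ : ℝ² → ℝ² be a smooth CKV of the flat Euclidean metric with conformal factor ψ, let a₀ ∈ ℝ, let b : ℝ² → ℝ be smooth, and let f : ℝ² × ℝ → ℝ be smooth. Assume the symmetry constraint holds identically in (x, u): Δb(x) − ξ^k(x) ∂_{x^k} f(x,u) − a₀ u ∂_u f(x,u) + (a₀ − 2ψ(x)) f(x,u) − b(x) ∂_u f(x,u) = 0. Then for every smooth solution u of the Poisson equation Δu = f(x,u) on ℝ², the characteristic function w = a₀ u + b − ξ^k ∂_k u satisfies the linearized equation Δw = ∂_u f(x, u(x)) · w. (This is the evolutionary form of the statement that X = ξ^i ∂_i + (a₀ u + b) ∂_u is a Lie point symmetry of the two-dimensional Poisson equation.) -/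

import Mathlib

/-- Partial derivative `∂f/∂xⁱ` of a function `f : ℝⁿ → ℝ`. -/
noncomputable def pd {n : ℕ} (i : Fin n) (f : (Fin n → ℝ) → ℝ) : (Fin n → ℝ) → ℝ :=
  fun x => fderiv ℝ f x (Pi.single i 1)

/-- The flat Laplacian `Δf = Σ_i ∂²f/∂(xⁱ)²`. -/
noncomputable def lap {n : ℕ} (f : (Fin n → ℝ) → ℝ) : (Fin n → ℝ) → ℝ :=
  fun x => ∑ i, pd i (pd i f) x

theorem pd_smooth {n : ℕ} (i : Fin n) {g : (Fin n → ℝ) → ℝ} (hg : ContDiff ℝ (⊤ : ℕ∞) g) :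
    ContDiff ℝ (⊤ : ℕ∞) (pd i g) := by
  have h : ContDiff ℝ (⊤ : ℕ∞) (fderiv ℝ g) := hg.fderiv_right (by simp)
  exact h.clm_apply contDiff_const

theorem sm_diff {n : ℕ} {g : (Fin n → ℝ) → ℝ} (hg : ContDiff ℝ (⊤ : ℕ∞) g) :
    Differentiable ℝ g := hg.differentiable (by simp)

theorem pd_add' {n : ℕ} (i : Fin n) {g h : (Fin n → ℝ) → ℝ} (hg : ContDiff ℝ (⊤ : ℕ∞) g)
    (hh : ContDiff ℝ (⊤ : ℕ∞) h) : pd i (fun y => g y + h y) = fun y => pd i g y + pd i h y := by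
  funext x
  have := ((sm_diff hg x).hasFDerivAt.add (sm_diff hh x).hasFDerivAt).fderiv
  simp only [pd]
  erw [this]
  rfl

theorem pd_sub' {n : ℕ} (i : Fin n) {g h : (Fin n → ℝ) → ℝ} (hg : ContDiff ℝ (⊤ : ℕ∞) g)
    (hh : ContDiff ℝ (⊤ : ℕ∞) h) : pd i (fun y => g y - h y) = fun y => pd i g y - pd i h y := by
  funext x
  have := ((sm_diff hg x).hasFDerivAt.sub (sm_diff hh x).hasFDerivAt).fderiv
  simp only [pd]
  erw [this]
  rfl

theorem pd_mul' {n : ℕ} (i : Fin n) {g h : (Fin n → ℝ) → ℝ} (hg : ContDiff ℝ (⊤ : ℕ∞) g)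
    (hh : ContDiff ℝ (⊤ : ℕ∞) h) :
    pd i (fun y => g y * h y) = fun y => g y * pd i h y + pd i g y * h y := by
  funext x
  have := ((sm_diff hg x).hasFDerivAt.mul (sm_diff hh x).hasFDerivAt).fderiv
  simp only [pd]
  erw [this]
  simp [mul_comm]

theorem pd_cmul' {n : ℕ} (i : Fin n) (c : ℝ) {h : (Fin n → ℝ) → ℝ}
    (hh : ContDiff ℝ (⊤ : ℕ∞) h) :
    pd i (fun y => c * h y) = fun y => c * pd i h y := by
  funext x
  have := ((sm_diff hh x).hasFDerivAt.const_mul c).fderiv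
  simp only [pd]
  erw [this]
  rfl

theorem pd_comm' {n : ℕ} (i j : Fin n) {g : (Fin n → ℝ) → ℝ} (hg : ContDiff ℝ (⊤ : ℕ∞) g)
    (x : Fin n → ℝ) : pd i (pd j g) x = pd j (pd i g) x := by
  have h : ContDiff ℝ (⊤ : ℕ∞) (fderiv ℝ g) := hg.fderiv_right (by simp)
  have hd : DifferentiableAt ℝ (fderiv ℝ g) x := h.differentiable (by simp) x
  have key : ∀ v w : Fin n → ℝ, fderiv ℝ (fun y => fderiv ℝ g y v) x w
      = fderiv ℝ (fderiv ℝ g) x w v := by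
    intro v w
    rw [fderiv_clm_apply hd (differentiableAt_const v)]
    simp
  have hs : IsSymmSndFDerivAt ℝ g x := hg.contDiffAt.isSymmSndFDerivAt (by
    simp only [minSmoothness_of_isRCLikeNormedField]
    exact WithTop.coe_le_coe.2 le_top)
  change fderiv ℝ (fun y => fderiv ℝ g y _) x _ = fderiv ℝ (fun y => fderiv ℝ g y _) x _
  rw [key, key]
  exact hs _ _

theorem pd_chain' {n : ℕ} (k : Fin n) (f : (Fin n → ℝ) → ℝ → ℝ)
    (hf : ContDiff ℝ (⊤ : ℕ∞) (fun p : (Fin n → ℝ) × ℝ => f p.1 p.2))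
    {u : (Fin n → ℝ) → ℝ} (hu : ContDiff ℝ (⊤ : ℕ∞) u) (x : Fin n → ℝ) :
    pd k (fun y => f y (u y)) x
      = pd k (fun y => f y (u x)) x + deriv (f x) (u x) * pd k u x := by
  set F := fun p : (Fin n → ℝ) × ℝ => f p.1 p.2 with hF
  have hd : HasFDerivAt F (fderiv ℝ F (x, u x)) (x, u x) :=
    (hf.differentiable (by simp) _).hasFDerivAt
  have h1 : HasFDerivAt (fun y => f y (u y)) _ x :=
    HasFDerivAt.comp (g := F) (f := fun y => (y, u y)) x hd
      ((hasFDerivAt_id x).prodMk (sm_diff hu x).hasFDerivAt)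
  have h2 : HasFDerivAt (fun y => f y (u x)) _ x :=
    HasFDerivAt.comp (g := F) (f := fun y => (y, u x)) x hd
      ((hasFDerivAt_id x).prodMk (hasFDerivAt_const (u x) x))
  have h3 : HasDerivAt (f x) _ (u x) :=
    HasFDerivAt.comp_hasDerivAt (l := F) (f := fun t => (x, t)) (u x) hd
      ((hasDerivAt_const (u x) x).prodMk (hasDerivAt_id (u x)))
  rw [h3.deriv]
  simp only [pd]
  rw [h1.fderiv, h2.fderiv]
  simp only [ContinuousLinearMap.comp_apply, ContinuousLinearMap.prod_apply,
    ContinuousLinearMap.id_apply, zero_apply]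
  generalize fderiv ℝ u x (Pi.single k 1) = c
  generalize fderiv ℝ F (x, u x) = L
  have : ((Pi.single k 1 : Fin n → ℝ), c)
      = ((Pi.single k 1 : Fin n → ℝ), (0 : ℝ)) + c • ((0 : Fin n → ℝ), (1 : ℝ)) := by
    simp
  rw [this, map_add, map_smul, smul_eq_mul, mul_comm]

/-- Lie point symmetries of the two-dimensional Poisson equation `Δu = f(x,u)`
in evolutionary form: if `ξ` is a flat CKV of ℝ² with conformal factor `ψ` and the symmetry
constraint holds identically, then for any smooth solution `u` of `Δu = f(x,u)` the
characteristic `w = a₀ u + b − ξ^k ∂_k u` solves `Δw = f_u(x,u) w`. -/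
theorem stmt_5
    (ξ : Fin 2 → (Fin 2 → ℝ) → ℝ) (ψ : (Fin 2 → ℝ) → ℝ)
    (hξ : ∀ i, ContDiff ℝ (⊤ : ℕ∞) (ξ i))
    (hckv : ∀ i j x, pd i (ξ j) x + pd j (ξ i) x =
      2 * ψ x * (if i = j then (1 : ℝ) else 0))
    (a₀ : ℝ) (b : (Fin 2 → ℝ) → ℝ) (hb : ContDiff ℝ (⊤ : ℕ∞) b)
    (f : (Fin 2 → ℝ) → ℝ → ℝ)
    (hf : ContDiff ℝ (⊤ : ℕ∞) (fun p : (Fin 2 → ℝ) × ℝ => f p.1 p.2))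
    (hconstraint : ∀ (x : Fin 2 → ℝ) (u : ℝ),
      lap b x - (∑ k, ξ k x * pd k (fun y => f y u) x)
        - a₀ * u * deriv (f x) u + (a₀ - 2 * ψ x) * f x u
        - b x * deriv (f x) u = 0) :
    ∀ u : (Fin 2 → ℝ) → ℝ, ContDiff ℝ (⊤ : ℕ∞) u → (∀ x, lap u x = f x (u x)) →
      ∀ x, lap (fun y => a₀ * u y + b y - ∑ k, ξ k y * pd k u y) x
        = deriv (f x) (u x) * (a₀ * u x + b x - ∑ k, ξ k x * pd k u x) := by
  intro u hu hsol x
  have hpu : ∀ k, ContDiff ℝ (⊤ : ℕ∞) (pd k u) := fun k => pd_smooth k hu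
  have hppu : ∀ j k, ContDiff ℝ (⊤ : ℕ∞) (pd j (pd k u)) := fun j k => pd_smooth j (hpu k)
  have hpξ : ∀ j k, ContDiff ℝ (⊤ : ℕ∞) (pd j (ξ k)) := fun j k => pd_smooth j (hξ k)
  have e1 : ∀ i, pd i (fun y => a₀ * u y + b y - (ξ 0 y * pd 0 u y + ξ 1 y * pd 1 u y))
      = fun y => a₀ * pd i u y + pd i b y - ((ξ 0 y * pd i (pd 0 u) y + pd i (ξ 0) y * pd 0 u y)
        + (ξ 1 y * pd i (pd 1 u) y + pd i (ξ 1) y * pd 1 u y)) := by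
    intro i
    rw [pd_sub' i ((contDiff_const.mul hu).add hb)
        (((hξ 0).mul (hpu 0)).add ((hξ 1).mul (hpu 1))),
      pd_add' i (contDiff_const.mul hu) hb, pd_cmul' i a₀ hu,
      pd_add' i ((hξ 0).mul (hpu 0)) ((hξ 1).mul (hpu 1)),
      pd_mul' i (hξ 0) (hpu 0), pd_mul' i (hξ 1) (hpu 1)]
  have e2 : ∀ i, pd i (fun y => a₀ * pd i u y + pd i b y
        - ((ξ 0 y * pd i (pd 0 u) y + pd i (ξ 0) y * pd 0 u y)
        + (ξ 1 y * pd i (pd 1 u) y + pd i (ξ 1) y * pd 1 u y)))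
      = fun y => a₀ * pd i (pd i u) y + pd i (pd i b) y
        - (((ξ 0 y * pd i (pd i (pd 0 u)) y + pd i (ξ 0) y * pd i (pd 0 u) y)
            + (pd i (ξ 0) y * pd i (pd 0 u) y + pd i (pd i (ξ 0)) y * pd 0 u y))
          + ((ξ 1 y * pd i (pd i (pd 1 u)) y + pd i (ξ 1) y * pd i (pd 1 u) y)
            + (pd i (ξ 1) y * pd i (pd 1 u) y + pd i (pd i (ξ 1)) y * pd 1 u y))) := by
    intro i
    have A : ∀ k, ContDiff ℝ (⊤ : ℕ∞) (fun y => ξ k y * pd i (pd k u) y) :=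
      fun k => (hξ k).mul (hppu i k)
    have B : ∀ k, ContDiff ℝ (⊤ : ℕ∞) (fun y => pd i (ξ k) y * pd k u y) :=
      fun k => (hpξ i k).mul (hpu k)
    rw [pd_sub' i ((contDiff_const.mul (hpu i)).add (pd_smooth i hb))
        (((A 0).add (B 0)).add ((A 1).add (B 1))),
      pd_add' i (contDiff_const.mul (hpu i)) (pd_smooth i hb), pd_cmul' i a₀ (hpu i),
      pd_add' i ((A 0).add (B 0)) ((A 1).add (B 1)),
      pd_add' i (A 0) (B 0), pd_add' i (A 1) (B 1),
      pd_mul' i (hξ 0) (hppu i 0), pd_mul' i (hξ 1) (hppu i 1),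
      pd_mul' i (hpξ i 0) (hpu 0), pd_mul' i (hpξ i 1) (hpu 1)]
  -- derivative of the equation
  have e3 : ∀ k, pd 0 (pd 0 (pd k u)) x + pd 1 (pd 1 (pd k u)) x
      = pd k (fun y => f y (u x)) x + deriv (f x) (u x) * pd k u x := by
    intro k
    rw [← pd_chain' k f hf hu x]
    have h : (fun y => f y (u y)) = fun y => pd 0 (pd 0 u) y + pd 1 (pd 1 u) y := by
      funext y
      rw [← hsol y]
      simp [lap, Fin.sum_univ_two]
    rw [h, pd_add' k (hppu 0 0) (hppu 1 1)]
    have c : ∀ j, pd j (pd j (pd k u)) x = pd k (pd j (pd j u)) x := by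
      intro j
      have h0 : pd j (pd k u) = pd k (pd j u) := funext fun y => pd_comm' j k hu y
      rw [h0, pd_comm' j k (hpu j)]
    simp only [c]
  -- conformal Killing equations
  have k00 : ∀ y, pd 0 (ξ 0) y = ψ y := fun y => by
    have := hckv 0 0 y
    simp at this
    linarith
  have k11 : ∀ y, pd 1 (ξ 1) y = ψ y := fun y => by
    have := hckv 1 1 y
    simp at this
    linarith
  have k01 : ∀ y, pd 0 (ξ 1) y = (-1) * pd 1 (ξ 0) y := fun y => by
    have := hckv 0 1 y
    simp at this
    linarith
  have k10 : ∀ y, pd 1 (ξ 0) y = (-1) * pd 0 (ξ 1) y := fun y => by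
    have := k01 y
    linarith
  have kk : pd 0 (ξ 0) = pd 1 (ξ 1) := funext fun y => (k00 y).trans (k11 y).symm
  have l0 : pd 0 (pd 0 (ξ 0)) x + pd 1 (pd 1 (ξ 0)) x = 0 := by
    rw [kk, show pd 1 (ξ 0) = fun y => (-1) * pd 0 (ξ 1) y from funext k10,
      pd_cmul' 1 (-1) (hpξ 0 1), pd_comm' 0 1 (hξ 1)]
    ring
  have l1 : pd 0 (pd 0 (ξ 1)) x + pd 1 (pd 1 (ξ 1)) x = 0 := by
    rw [← kk, show pd 0 (ξ 1) = fun y => (-1) * pd 1 (ξ 0) y from funext k01,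
      pd_cmul' 0 (-1) (hpξ 1 0), pd_comm' 1 0 (hξ 0)]
    ring
  have hc := hconstraint x (u x)
  have hs := hsol x
  have e30 := e3 0
  have e31 := e3 1
  have hcm := pd_comm' 0 1 hu x
  simp only [lap, Fin.sum_univ_two] at hc hs ⊢
  rw [e1, e1, e2, e2]
  simp only [k00, k11, k01]
  rw [hcm]
  linear_combination hc - ξ 0 x * e30 - ξ 1 x * e31 - pd 0 u x * l0 - pd 1 u x * l1
    + (a₀ - 2 * ψ x) * hs
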